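/- Let X and Y be discrete random variables taking values in a finite set 𝒳 and in 𝒴 = {-1,1} respectively, with joint distribution P, let f : 𝒳 → 𝒵 be any function and F = f(X). Then I_P(X;Y) = I_P(F;Y) if and only if the map x ↦ P(Y=1|X=x) is constant on every set of the form f⁻¹(z) ∩ supp(P_X) for z ∈ 𝒵. -/

import Mathlib

open Finset

noncomputable section

/-- The binary label space `𝒴 = {-1, 1} ⊆ ℤ`. -/
abbrev Ybin : Type := ({-1, 1} : Finset ℤ)

/-- The label `+1` as an element of `Ybin`. -/
def yPos : Ybin := ⟨1, by decide⟩

/-- The label `-1` as an element of `Ybin`. -/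
def yNeg : Ybin := ⟨-1, by decide⟩

/-- Probability of a set under a finitely supported pmf `P`. -/
def pr {Ω : Type*} [Fintype Ω] (P : Ω → ℝ) (s : Set Ω) : ℝ :=
  ∑ ω, s.indicator P ω

/-- Entropy `H_P(A)` of a random variable `A` (a function of the sample point),
`H_P(A) = -∑_a P(A=a) log P(A=a)`, written as a sum over sample points. -/
def ent {Ω α : Type*} [Fintype Ω] (P : Ω → ℝ) (A : Ω → α) : ℝ :=
  -∑ ω, P ω * Real.log (pr P {ω' | A ω' = A ω})

/-- Conditional entropy `H_P(A|B) = -∑_{a,b} P(A=a,B=b) log P(A=a|B=b)`. -/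
def condEnt {Ω α β : Type*} [Fintype Ω] (P : Ω → ℝ) (A : Ω → α) (B : Ω → β) : ℝ :=
  -∑ ω, P ω * Real.log (pr P {ω' | A ω' = A ω ∧ B ω' = B ω} / pr P {ω' | B ω' = B ω})

/-- Mutual information `I_P(A;B) = ∑_{a,b} P(A=a,B=b) log (P(A=a,B=b) / (P(A=a) P(B=b)))`. -/
def mi {Ω α β : Type*} [Fintype Ω] (P : Ω → ℝ) (A : Ω → α) (B : Ω → β) : ℝ :=
  ∑ ω, P ω * Real.log (pr P {ω' | A ω' = A ω ∧ B ω' = B ω} /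
      (pr P {ω' | A ω' = A ω} * pr P {ω' | B ω' = B ω}))

/-- Marginal `P_X(x) = ∑_y P(x,y)`. -/
def margX {𝒳 : Type*} [Fintype 𝒳] (P : 𝒳 × Ybin → ℝ) (x : 𝒳) : ℝ :=
  ∑ y, P (x, y)

/-- Risk `R_P(h) = P[sign(h(X)) ≠ Y]`. -/
def risk {𝒳 : Type*} [Fintype 𝒳] (P : 𝒳 × Ybin → ℝ) (h : 𝒳 → ℝ) : ℝ :=
  pr P {ω | Real.sign (h ω.1) ≠ ((ω.2 : ℤ) : ℝ)}


/-- Equality case of Gibbs' inequality for two finite families of equal total mass. -/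
lemma sum_mul_log_div_eq_zero_iff {ι : Type*} [Fintype ι] {p w : ι → ℝ}
    (hp : ∀ i, 0 ≤ p i) (hw : ∀ i, 0 ≤ w i) (hwp : ∀ i, w i = 0 → p i = 0)
    (hsum : ∑ i, p i = ∑ i, w i) :
    ∑ i, p i * Real.log (p i / w i) = 0 ↔ ∀ i, p i = w i := by
  have hterm : ∀ i, w i * InformationTheory.klFun (p i / w i) =
      p i * Real.log (p i / w i) + (w i - p i) := by
    intro i
    rw [InformationTheory.klFun_apply]
    rcases eq_or_ne (w i) 0 with h | h
    · simp [h, hwp i h]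
    · field_simp
      ring
  have hkl : ∑ i, p i * Real.log (p i / w i) =
      ∑ i, w i * InformationTheory.klFun (p i / w i) := by
    simp_rw [hterm, sum_add_distrib, sum_sub_distrib, hsum]
    ring
  have hdiv : ∀ i, 0 ≤ p i / w i := fun i => div_nonneg (hp i) (hw i)
  rw [hkl, sum_eq_zero_iff_of_nonneg fun i _ =>
    mul_nonneg (hw i) (InformationTheory.klFun_nonneg (hdiv i))]
  refine ⟨fun h i => ?_, fun h i _ => ?_⟩
  · rcases mul_eq_zero.mp (h i (mem_univ i)) with h0 | h0
    · rw [h0, hwp i h0]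
    · rw [InformationTheory.klFun_eq_zero_iff (hdiv i)] at h0
      exact (div_eq_one_iff_eq fun hz => by simp [hz] at h0).mp h0
  · rcases eq_or_ne (w i) 0 with h0 | h0
    · simp [h0]
    · rw [h i, div_self h0, InformationTheory.klFun_one, mul_zero]

lemma pr_mono {Ω : Type*} [Fintype Ω] {P : Ω → ℝ} (hP : ∀ ω, 0 ≤ P ω) {s t : Set Ω}
    (hst : s ⊆ t) : pr P s ≤ pr P t :=
  sum_le_sum fun ω _ => Set.indicator_le_indicator_of_subset hst hP ω

lemma pr_nonneg {Ω : Type*} [Fintype Ω] {P : Ω → ℝ} (hP : ∀ ω, 0 ≤ P ω) (s : Set Ω) :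
    0 ≤ pr P s :=
  sum_nonneg fun ω _ => Set.indicator_nonneg (fun ω _ => hP ω) ω

lemma le_pr_of_mem {Ω : Type*} [Fintype Ω] {P : Ω → ℝ} (hP : ∀ ω, 0 ≤ P ω) {s : Set Ω}
    {ω : Ω} (hω : ω ∈ s) : P ω ≤ pr P s := by
  rw [← Set.indicator_of_mem hω P]
  exact single_le_sum (f := s.indicator P)
    (fun ω _ => Set.indicator_nonneg (fun ω _ => hP ω) ω) (mem_univ ω)

lemma sum_Ybin (g : Ybin → ℝ) : ∑ y, g y = g yPos + g yNeg := by
  have huniv : (univ : Finset Ybin) = {yPos, yNeg} := by decide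
  rw [huniv, sum_pair (by decide)]

section Fibers

variable {𝒳 𝒵 : Type*} [Fintype 𝒳] (P : 𝒳 × Ybin → ℝ) (f : 𝒳 → 𝒵)

open Classical in
lemma pr_fiber_inter (z : 𝒵) (y : Ybin) :
    pr P {ω | f ω.1 = z ∧ ω.2 = y} = ∑ x with f x = z, P (x, y) := by
  simp only [pr, Set.indicator_apply, Set.mem_ofPred_eq, Fintype.sum_prod_type, sum_filter, ite_and]
  refine sum_congr rfl fun x _ => ?_
  split_ifs
  · simp only [sum_ite_eq', mem_univ, if_true]
  · simp only [sum_const_zero]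

open Classical in
lemma pr_fiber (z : 𝒵) : pr P {ω | f ω.1 = z} = ∑ x with f x = z, margX P x := by
  simp only [pr, margX, Set.indicator_apply, Set.mem_ofPred_eq, Fintype.sum_prod_type, sum_filter]
  refine sum_congr rfl fun x _ => ?_
  split_ifs <;> simp

lemma pr_fiber_eq_sum (z : 𝒵) :
    pr P {ω | f ω.1 = z} = ∑ y, pr P {ω | f ω.1 = z ∧ ω.2 = y} := by
  classical
  simp_rw [pr_fiber, pr_fiber_inter, margX]
  exact sum_comm

lemma pr_fst_eq (x : 𝒳) : pr P {ω | ω.1 = x} = margX P x := by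
  classical
  simpa [sum_filter] using pr_fiber P id x

lemma pr_fst_snd_eq (x : 𝒳) (y : Ybin) : pr P {ω | ω.1 = x ∧ ω.2 = y} = P (x, y) := by
  classical
  simpa [sum_filter] using pr_fiber_inter P id x y

variable {P}

lemma margX_nonneg (hP : ∀ ω, 0 ≤ P ω) (x : 𝒳) : 0 ≤ margX P x :=
  sum_nonneg fun _ _ => hP _

lemma le_margX (hP : ∀ ω, 0 ≤ P ω) (x : 𝒳) (y : Ybin) : P (x, y) ≤ margX P x :=
  single_le_sum (f := fun y => P (x, y)) (fun _ _ => hP _) (mem_univ y)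

lemma margX_le_pr_fiber (hP : ∀ ω, 0 ≤ P ω) (x : 𝒳) :
    margX P x ≤ pr P {ω | f ω.1 = f x} := by
  rw [← pr_fst_eq]
  exact pr_mono hP fun ω hω => congrArg f hω

/-- Mutual information is preserved by `f` iff `X` and `Y` are conditionally independent
given `f(X)`. -/
lemma mi_eq_mi_comp_iff (hP : ∀ ω, 0 ≤ P ω) :
    mi P (fun ω => ω.1) (fun ω => ω.2) = mi P (fun ω => f ω.1) (fun ω => ω.2) ↔
      ∀ x y, P (x, y) =
        margX P x * pr P {ω | f ω.1 = f x ∧ ω.2 = y} / pr P {ω | f ω.1 = f x} := by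
  have hpos : ∀ x y, 0 < P (x, y) → 0 < margX P x ∧
      0 < pr P {ω | f ω.1 = f x ∧ ω.2 = y} ∧ 0 < pr P {ω | f ω.1 = f x} ∧
      0 < pr P {ω | ω.2 = y} := fun x y h =>
    ⟨h.trans_le (le_margX hP x y), h.trans_le (le_pr_of_mem hP ⟨rfl, rfl⟩),
      h.trans_le (le_pr_of_mem hP rfl), h.trans_le (le_pr_of_mem hP rfl)⟩
  have hgibbs := sum_mul_log_div_eq_zero_iff (p := P)
    (w := fun ω => margX P ω.1 * pr P {ω' | f ω'.1 = f ω.1 ∧ ω'.2 = ω.2} /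
      pr P {ω' | f ω'.1 = f ω.1}) hP
    (fun ω => div_nonneg (mul_nonneg (margX_nonneg hP _) (pr_nonneg hP _)) (pr_nonneg hP _))
    (fun ω h => by
      by_contra hne
      obtain ⟨h₁, h₂, h₃, -⟩ := hpos ω.1 ω.2 ((hP ω).lt_of_ne' hne)
      exact (div_pos (mul_pos h₁ h₂) h₃).ne' h)
    (by
      simp_rw [Fintype.sum_prod_type]
      refine sum_congr rfl fun x _ => ?_
      rw [← sum_div, ← mul_sum, ← pr_fiber_eq_sum]
      rcases eq_or_ne (pr P {ω | f ω.1 = f x}) 0 with h | h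
      · have := margX_le_pr_fiber f hP x
        rw [h, div_zero]
        exact le_antisymm (this.trans_eq h) (margX_nonneg hP x)
      · rw [mul_div_cancel_right₀ _ h, margX])
  rw [Prod.forall] at hgibbs
  rw [← hgibbs, ← sub_eq_zero, mi, mi, ← sum_sub_distrib]
  refine Eq.congr_left (sum_congr rfl fun ω _ => ?_)
  obtain ⟨x, y⟩ := ω
  rcases (hP (x, y)).eq_or_lt with h | h
  · simp [← h]
  obtain ⟨h₁, h₂, h₃, h₄⟩ := hpos x y h
  rw [pr_fst_snd_eq, pr_fst_eq, ← mul_sub, ← Real.log_div (by positivity) (by positivity)]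
  congr 2
  field_simp

end Fibers

/-- For any `f : 𝒳 → 𝒵` with `F = f(X)`, we have `I_P(X;Y) = I_P(F;Y)` iff
the map `x ↦ P(Y=1|X=x)` is constant on every set `f⁻¹(z) ∩ supp(P_X)`, `z ∈ 𝒵`. -/
theorem lossless_iff_condProb_constant_on_fibers {𝒳 𝒵 : Type*} [Fintype 𝒳]
    (P : 𝒳 × Ybin → ℝ) (hP0 : ∀ ω, 0 ≤ P ω) (hP1 : ∑ ω, P ω = 1)
    (f : 𝒳 → 𝒵) :
    mi P (fun ω => ω.1) (fun ω => ω.2) = mi P (fun ω => f ω.1) (fun ω => ω.2) ↔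
      ∀ z : 𝒵, ∀ x₁ ∈ f ⁻¹' {z} ∩ {x | 0 < margX P x},
        ∀ x₂ ∈ f ⁻¹' {z} ∩ {x | 0 < margX P x},
          P (x₁, yPos) / margX P x₁ = P (x₂, yPos) / margX P x₂ := by
    classical
  rw [mi_eq_mi_comp_iff f hP0]
  constructor
  · rintro h z x₁ ⟨rfl, hx₁⟩ x₂ ⟨hx, hx₂⟩
    rw [Set.mem_preimage, Set.mem_singleton_iff] at hx
    rw [Set.mem_ofPred_eq] at hx₁ hx₂
    rw [h x₁, h x₂, hx]
    field_simp
  · intro h x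
    rcases (margX_nonneg hP0 x).eq_or_lt with hx | hx
    · intro y
      rw [← hx, zero_mul, zero_div]
      exact le_antisymm ((le_margX hP0 x y).trans_eq hx.symm) (hP0 _)
    have hr : 0 < pr P {ω | f ω.1 = f x} := hx.trans_le (margX_le_pr_fiber f hP0 x)
    have hq : pr P {ω | f ω.1 = f x ∧ ω.2 = yPos} =
        P (x, yPos) / margX P x * pr P {ω | f ω.1 = f x} := by
      rw [pr_fiber_inter, pr_fiber, mul_sum]
      refine sum_congr rfl fun x' hx' => ?_
      rcases (margX_nonneg hP0 x').eq_or_lt with h0 | h0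
      · rw [← h0, mul_zero]
        exact le_antisymm ((le_margX hP0 x' _).trans_eq h0.symm) (hP0 _)
      · rw [h (f x) x ⟨rfl, hx⟩ x' ⟨(mem_filter.mp hx').2, h0⟩, div_mul_cancel₀ _ h0.ne']
    have hpos : P (x, yPos) =
        margX P x * pr P {ω | f ω.1 = f x ∧ ω.2 = yPos} / pr P {ω | f ω.1 = f x} := by
      rw [hq]
      field_simp
    have hneg : P (x, yNeg) =
        margX P x * pr P {ω | f ω.1 = f x ∧ ω.2 = yNeg} / pr P {ω | f ω.1 = f x} := by
      have hm : margX P x = P (x, yPos) + P (x, yNeg) := sum_Ybin _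
      have hs := pr_fiber_eq_sum P f (f x)
      rw [sum_Ybin] at hs
      rw [eq_div_iff hr.ne'] at hpos ⊢
      linear_combination margX P x * hs - hpos - pr P {ω | f ω.1 = f x} * hm
    have hy : ∀ y : Ybin, y = yPos ∨ y = yNeg := by decide
    intro y
    rcases hy y with rfl | rfl
    exacts [hpos, hneg]
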